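/- Let x ∈ X_s (the switch count of x is constant under iteration of the corrected BFO rule) and let b be a maximal ordered block in x ending with 11. Then F(x) contains an ordered block strictly longer than b. -/

import Mathlib

/-- The parity (XOR of all cells) of a cyclic binary configuration. -/
def Par {n : ℕ} [NeZero n] (x : ZMod n → Bool) : ZMod 2 :=
  ∑ i : ZMod n, if x i then 1 else 0

/-- The global CA rule induced by a local rule of radius `r`
on cyclic configurations of length `n`. -/
def globalRule (r : ℕ) (f : (Fin (2*r+1) → Bool) → Bool) {n : ℕ}
    (x : ZMod n → Bool) : ZMod n → Bool :=
  fun i => f (fun j => x (i + ((j : ℕ) : ZMod n) - (r : ZMod n)))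

/-- The active (center-flipping) neighbourhoods of the corrected BFO rule
(transitions T1–T12; the center is cell 4 of 9). -/
def bfoActive (w : Fin 9 → Bool) : Bool :=
  (w 1 && w 2 && w 3 && !w 4 && !w 5) ||               -- T1
  (w 0 && w 1 && w 2 && !w 3 && !w 4) ||               -- T2
  (!w 1 && !w 2 && w 3 && !w 4 && !w 5) ||             -- T3
  (!w 0 && !w 1 && w 2 && !w 3 && !w 4) ||             -- T4
  (!w 3 && w 4 && w 5 && !w 6) ||                      -- T5
  (!w 2 && w 3 && w 4 && !w 5) ||                      -- T6
  (!w 1 && !w 2 && w 3 && !w 4 && w 5 && !w 6) ||      -- T7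
  (!w 2 && !w 3 && w 4 && !w 5 && w 6 && !w 7) ||      -- T8
  (w 3 && w 4 && w 5 && !w 6 && w 7) ||                -- T9
  (w 0 && w 1 && w 2 && !w 3 && w 4 && !w 5) ||        -- T10
  (w 0 && w 1 && w 2 && !w 3 && w 4 && w 5 && w 6) ||  -- T11
  (w 2 && w 3 && w 4 && !w 5 && w 6 && w 7 && !w 8)    -- T12

/-- The corrected BFO local rule (radius 4). -/
def bfoLocal (w : Fin 9 → Bool) : Bool := xor (bfoActive w) (w 4)

/-- The global rule induced by the corrected BFO rule. -/
def bfoGlobal {n : ℕ} (x : ZMod n → Bool) : ZMod n → Bool :=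
  globalRule 4 bfoLocal x

/-- `x i x (i+1)` is a box: the pattern 01 preceded by 1 and followed by 00. -/
def IsBox {n : ℕ} (x : ZMod n → Bool) (i : ZMod n) : Prop :=
  x (i-1) = true ∧ x i = false ∧ x (i+1) = true ∧ x (i+2) = false ∧ x (i+3) = false

/-- Cell `j` belongs to some box of `x`. -/
def InBox {n : ℕ} (x : ZMod n → Bool) (j : ZMod n) : Prop :=
  ∃ i, IsBox x i ∧ (j = i ∨ j = i + 1)

/-- `x` has a switch at position `i`: either a b-switch (a box at `i+1`)
or an r-switch (`x i ≠ x (i+1)` with neither cell in a box). -/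
def IsSwitch {n : ℕ} (x : ZMod n → Bool) (i : ZMod n) : Prop :=
  IsBox x (i+1) ∨ (x i ≠ x (i+1) ∧ ¬ InBox x i ∧ ¬ InBox x (i+1))

/-- The number of switches of the configuration `x`. -/
noncomputable def switchCount {n : ℕ} (x : ZMod n → Bool) : ℕ :=
  Nat.card {i : ZMod n // IsSwitch x i}

/-- The block of length `2k+2` starting at position `i` is an ordered block. -/
def IsOrderedBlock {n : ℕ} (x : ZMod n → Bool) (i : ZMod n) (k : ℕ) : Prop :=
  (∀ j ≤ k, ¬ (x (i + 2*j) = true ∧ x (i + 2*j + 1) = false)) ∧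
  (x i = false ∧ x (i+1) = true) ∧
  ¬ (x (i + 2*k) = false ∧ x (i + 2*k + 1) = true) ∧
  (x (i + 2*k) = true ∧ x (i + 2*k + 1) = true → x (i + 2*k + 2) = false)

/-- An ordered block which is not a proper sub-block of another ordered block. -/
def IsMaximalOrderedBlock {n : ℕ} (x : ZMod n → Bool) (i : ZMod n) (k : ℕ) : Prop :=
  IsOrderedBlock x i k ∧
  ∀ (i' : ZMod n) (k' d : ℕ), IsOrderedBlock x i' k' →
    i = i' + 2*d → 2*d + 2*k + 2 ≤ 2*k' + 2 → d = 0 ∧ k = k'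

/-- `x` contains the word `w` starting at position `i`. -/
def ContainsAt {n : ℕ} (x : ZMod n → Bool) (i : ZMod n) (w : List Bool) : Prop :=
  ∀ j : Fin w.length, x (i + ((j : ℕ) : ZMod n)) = w.get j

/-- `x` belongs to `X_s`: the switch count is constant during the whole evolution
under the corrected BFO rule. -/
def InXs {n : ℕ} (x : ZMod n → Bool) : Prop :=
  ∀ t : ℕ, switchCount (bfoGlobal^[t] x) = switchCount x

/-- Membership of the neighbourhood of cell `i` in one of the AT pairs
`T_{1,2}`, `T_{3,4}` (center at `i`). -/
def MatchT1234 {n : ℕ} (y : ZMod n → Bool) (i : ZMod n) : Prop :=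
  (y (i-3) = true ∧ y (i-2) = true ∧ y (i-1) = true ∧ y i = false ∧ y (i+1) = false) ∨
  (y (i-4) = true ∧ y (i-3) = true ∧ y (i-2) = true ∧ y (i-1) = false ∧ y i = false) ∨
  (y (i-3) = false ∧ y (i-2) = false ∧ y (i-1) = true ∧ y i = false ∧ y (i+1) = false) ∨
  (y (i-4) = false ∧ y (i-3) = false ∧ y (i-2) = true ∧ y (i-1) = false ∧ y i = false)

/-- The `k`-fold concatenation of a configuration of length `n`. -/
def concatK {n : ℕ} (k : ℕ) (x : ZMod n → Bool) : ZMod (k*n) → Bool :=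
  fun i => x ((i.val : ZMod n))

namespace BFO
/-- The corrected BFO rule as a function of nine bits. -/
def F9 (a b c d e f g h k : Bool) : Bool :=
  xor
   ((b && c && d && !e && !f) || (a && b && c && !d && !e) ||
    (!b && !c && d && !e && !f) || (!a && !b && c && !d && !e) ||
    (!d && e && f && !g) || (!c && d && e && !f) ||
    (!b && !c && d && !e && f && !g) || (!c && !d && e && !f && g && !h) ||
    (d && e && f && !g && h) || (a && b && c && !d && e && !f) ||
    (a && b && c && !d && e && f && g) || (c && d && e && !f && g && h && !k)) e

/-- The word `10100`. -/
def bx (a b c d e : Bool) : Bool := a && !b && c && !d && !e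

/-- Index of a 9-bit word, most significant bit first. -/
def idx9 (a b c d e f g h k : Bool) : ℕ :=
  2 * (2 * (2 * (2 * (2 * (2 * (2 * (2 * a.toNat + b.toNat) + c.toNat) + d.toNat) + e.toNat)
    + f.toNat) + g.toNat) + h.toNat) + k.toNat

/-- Potential (values 0, 1, 2) on 9-bit words, tabulated by two bit masks. -/
def pot (a b c d e f g h k : Bool) : ℕ :=
  let m := idx9 a b c d e f g h k
  (Nat.land (Nat.shiftRight
    204584376572811011123787785712835598154254103242474782374663286475537054831227667469123427862646253365344601182987217108079171363549597561631444841727 m) 1) +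
  (Nat.land (Nat.shiftRight
    115069412561453867880538105959096305993645258636636161979406298347643654694217111959598647920542705323824119808 m) 1)

/-- A 13-bit window contains one of the reducing words at its designated offset. -/
def red (a b c d e f g h k l : Bool) : Bool :=
  (!a && b && c && !d && !e) ||
  (b && c && !d && !e && f && !g && h && k) ||
  (b && c && !d && !e && f && !g && !h) ||
  (b && c && !d && !e && f && g && h) ||
  (!c && !d && e && !f && !g && h && k && l) ||
  (!b && !c && d && !e && !f && g && !h && k && l) ||
  (!a && b && c && !d && e && !f && g) ||
  (!b && c && d && !e && f && g) ||
  (!c && !d && e && !f && g && !h && k) ||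
  (!b && !c && d && !e && !f && g && !h && !k)

/-- Boolean universal quantifier over `Bool`. -/
def allB (f : Bool → Bool) : Bool := f true && f false

theorem allB_iff (f : Bool → Bool) : allB f = true ↔ ∀ b, f b = true := by
  simp [allB, and_comm]

/-- The local inequality for one 13-bit window. -/
def chk (a b c d e f g h k l m n o : Bool) : Bool :=
  let y0 := F9 a b c d e f g h k
  let y1 := F9 b c d e f g h k l
  let y2 := F9 c d e f g h k l m
  let y3 := F9 d e f g h k l m n
  let y4 := F9 e f g h k l m n o
  Nat.ble ((red a b c d e f g h k l).toNat + (bx c d e f g).toNat + (!y1 && y2).toNat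
      + pot b c d e f g h k l)
    ((e && !f).toNat + (bx y0 y1 y2 y3 y4).toNat + pot a b c d e f g h k)

theorem chk_all : allB (fun a => allB fun b => allB fun c => allB fun d => allB fun e =>
    allB fun f => allB fun g => allB fun h => allB fun k => allB fun l => allB fun m =>
    allB fun n => allB fun o => chk a b c d e f g h k l m n o) = true := by
  decide +kernel

theorem chk_true (a b c d e f g h k l m n o : Bool) : chk a b c d e f g h k l m n o = true := by
  have H := chk_all
  simp only [allB_iff] at H
  exact H a b c d e f g h k l m n o

theorem glob_eq {n : ℕ} (x : ZMod n → Bool) (c : ZMod n) :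
    bfoGlobal x (c + 4) = F9 (x c) (x (c+1)) (x (c+2)) (x (c+3)) (x (c+4)) (x (c+5)) (x (c+6))
      (x (c+7)) (x (c+8)) := by
  have key : ∀ j : Fin 9, x (c + 4 + ((j : ℕ) : ZMod n) - ((4 : ℕ) : ZMod n))
      = x (c + ((j : ℕ) : ZMod n)) := by
    intro j; congr 1; push_cast; ring
  unfold bfoGlobal globalRule
  simp only [key]
  simp [bfoLocal, bfoActive, F9]

/-! ### Counting switches -/

/-- Indicator of a rise `01` at position `i`. -/
def riseN {n : ℕ} (x : ZMod n → Bool) (i : ZMod n) : ℕ := (!x i && x (i+1)).toNat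
/-- Indicator of a fall `10` at position `i`. -/
def fallN {n : ℕ} (x : ZMod n → Bool) (i : ZMod n) : ℕ := (x i && !x (i+1)).toNat
/-- Indicator of the word `10100` at position `i`. -/
def boxN {n : ℕ} (x : ZMod n → Bool) (i : ZMod n) : ℕ :=
  (bx (x i) (x (i+1)) (x (i+2)) (x (i+3)) (x (i+4))).toNat

theorem sum_shift {n : ℕ} [NeZero n] (f : ZMod n → ℕ) (c : ZMod n) :
    ∑ i, f (i + c) = ∑ i, f i :=
  Equiv.sum_comp (Equiv.addRight c) f

theorem isBox_iff {n : ℕ} (x : ZMod n → Bool) (i : ZMod n) :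
    IsBox x (i + 1) ↔ bx (x i) (x (i+1)) (x (i+2)) (x (i+3)) (x (i+4)) = true := by
  unfold IsBox bx
  rw [show i + 1 - 1 = i by ring, show i + 1 + 1 = i + 2 by ring, show i + 1 + 2 = i + 3 by ring,
    show i + 1 + 3 = i + 4 by ring]
  simp [and_assoc]

theorem inBox_iff {n : ℕ} (x : ZMod n → Bool) (j : ZMod n) :
    InBox x j ↔ IsBox x j ∨ IsBox x (j - 1) := by
  unfold InBox
  constructor
  · rintro ⟨i, h, rfl | rfl⟩
    · exact Or.inl h
    · right; simpa using h
  · rintro (h | h)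
    · exact ⟨j, h, Or.inl rfl⟩
    · exact ⟨j - 1, h, Or.inr (by ring)⟩

open Classical in
theorem switch_local {n : ℕ} (x : ZMod n → Bool) (c : ZMod n) :
    (if IsSwitch x (c+2) then 1 else 0) + boxN x (c+1) + boxN x c
      = riseN x (c+2) + fallN x (c+2) := by
  have e : IsSwitch x (c+2) ↔ (bx (x (c+2)) (x (c+3)) (x (c+4)) (x (c+5)) (x (c+6)) = true ∨
      (x (c+2) ≠ x (c+3) ∧
      ¬ (bx (x (c+1)) (x (c+2)) (x (c+3)) (x (c+4)) (x (c+5)) = true ∨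
         bx (x c) (x (c+1)) (x (c+2)) (x (c+3)) (x (c+4)) = true) ∧
      ¬ (bx (x (c+2)) (x (c+3)) (x (c+4)) (x (c+5)) (x (c+6)) = true ∨
         bx (x (c+1)) (x (c+2)) (x (c+3)) (x (c+4)) (x (c+5)) = true))) := by
    have h0 := isBox_iff x c
    have h1 := isBox_iff x (c+1)
    have h2 := isBox_iff x (c+2)
    unfold IsSwitch
    rw [inBox_iff, inBox_iff, show c + 2 + 1 - 1 = c + 1 + 1 by ring,
      show c + 2 - 1 = c + 1 by ring, h2, h0]
    rw [show (c + 2 : ZMod n) = c + 1 + 1 by ring, h1]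
    ring_nf
  simp only [e, boxN, riseN, fallN]
  rw [show c + 1 + 1 = c + 2 by ring, show c + 1 + 2 = c + 3 by ring,
    show c + 1 + 3 = c + 4 by ring, show c + 1 + 4 = c + 5 by ring,
    show c + 2 + 1 = c + 3 by ring]
  generalize x c = b0
  generalize x (c+1) = b1
  generalize x (c+2) = b2
  generalize x (c+3) = b3
  generalize x (c+4) = b4
  generalize x (c+5) = b5
  generalize x (c+6) = b6
  revert b0 b1 b2 b3 b4 b5 b6
  simp only [bx]
  decide

theorem rise_fall {n : ℕ} [NeZero n] (x : ZMod n → Bool) : ∑ i, riseN x i = ∑ i, fallN x i := by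
  have h : ∀ i, riseN x i + (x i).toNat = fallN x i + (x (i+1)).toNat := by
    intro i
    unfold riseN fallN
    cases x i <;> cases x (i+1) <;> rfl
  have h2 := Finset.sum_congr (rfl : (Finset.univ : Finset (ZMod n)) = _) (fun i _ => h i)
  rw [Finset.sum_add_distrib, Finset.sum_add_distrib,
    sum_shift (fun i => (x i).toNat) 1] at h2
  omega

theorem switchCount_eq {n : ℕ} [NeZero n] (x : ZMod n → Bool) :
    switchCount x + 2 * ∑ i, boxN x i = 2 * ∑ i, fallN x i := by
  classical
  have h1 : switchCount x = ∑ i, (if IsSwitch x i then 1 else 0) := by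
    unfold switchCount
    rw [Nat.card_eq_fintype_card, Fintype.card_subtype, Finset.card_filter]
  have h2 := Finset.sum_congr (rfl : (Finset.univ : Finset (ZMod n)) = _)
    (fun i _ => switch_local x i)
  rw [Finset.sum_add_distrib, Finset.sum_add_distrib, Finset.sum_add_distrib,
    sum_shift (fun i => if IsSwitch x i then 1 else 0) 2, sum_shift (boxN x) 1,
    sum_shift (riseN x) 2, sum_shift (fallN x) 2, rise_fall] at h2
  rw [h1]
  convert (show (_ : ℕ) = _ from ?_) using 1
  have h3 : ∀ (a b c : ℕ), a + b + b = c + c → a + 2 * b = 2 * c := by intros; omega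
  apply h3
  convert h2

/-- Potential of the nine cells starting at `c`. -/
def potN {n : ℕ} (x : ZMod n → Bool) (c : ZMod n) : ℕ :=
  pot (x c) (x (c+1)) (x (c+2)) (x (c+3)) (x (c+4)) (x (c+5)) (x (c+6)) (x (c+7)) (x (c+8))

/-- A reducing word occurs in the window starting at `c`. -/
def redB {n : ℕ} (x : ZMod n → Bool) (c : ZMod n) : Bool :=
  red (x c) (x (c+1)) (x (c+2)) (x (c+3)) (x (c+4)) (x (c+5)) (x (c+6)) (x (c+7)) (x (c+8))
    (x (c+9))

theorem local_ineq {n : ℕ} (x : ZMod n → Bool) (c : ZMod n) :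
    (redB x c).toNat + boxN x (c+2) + riseN (bfoGlobal x) (c+5) + potN x (c+1) ≤
      fallN x (c+4) + boxN (bfoGlobal x) (c+4) + potN x c := by
  have h := chk_true (x c) (x (c+1)) (x (c+2)) (x (c+3)) (x (c+4)) (x (c+5)) (x (c+6)) (x (c+7))
    (x (c+8)) (x (c+9)) (x (c+10)) (x (c+11)) (x (c+12))
  have g0 := glob_eq x c
  have g1 := glob_eq x (c+1)
  have g2 := glob_eq x (c+2)
  have g3 := glob_eq x (c+3)
  have g4 := glob_eq x (c+4)
  simp only [add_assoc] at g0 g1 g2 g3 g4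
  norm_num at g0 g1 g2 g3 g4
  unfold chk at h
  simp only [← g0, ← g1, ← g2, ← g3, ← g4] at h
  have h' := Nat.le_of_ble_eq_true h
  unfold redB boxN riseN fallN potN
  simp only [add_assoc]
  norm_num
  simpa only [add_assoc] using h'

theorem no_red {n : ℕ} [NeZero n] (x : ZMod n → Bool)
    (hs : switchCount (bfoGlobal x) = switchCount x) (c : ZMod n) : redB x c = false := by
  have e1 := switchCount_eq x
  have e2 := switchCount_eq (bfoGlobal x)
  rw [← rise_fall] at e2
  have h := Finset.sum_le_sum (fun i (_ : i ∈ (Finset.univ : Finset (ZMod n))) => local_ineq x i)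
  simp only [Finset.sum_add_distrib] at h
  rw [sum_shift (boxN x) 2, sum_shift (riseN (bfoGlobal x)) 5, sum_shift (potN x) 1,
    sum_shift (fallN x) 4, sum_shift (boxN (bfoGlobal x)) 4] at h
  have h0 : ∑ i, (redB x i).toNat = 0 := by omega
  have := (Finset.sum_eq_zero_iff.1 h0) c (Finset.mem_univ _)
  simpa using this

/-! ### Local behaviour of the rule on aligned pairs -/

theorem mid_bool (a b c d e f g h k l : Bool) :
    ¬ (c = true ∧ d = false) → ¬ (e = true ∧ f = false) → ¬ (g = true ∧ h = false) →
    ¬ (F9 a b c d e f g h k = true ∧ F9 b c d e f g h k l = false) := by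
  revert a b c d e f g h k l
  decide +kernel

theorem box_step (a b c d e f g h k l m n o : Bool) :
    c = false → d = false → e = true → f = false → g = true → h = false → k = false →
    F9 a b c d e f g h k = false ∧ F9 b c d e f g h k l = true ∧ F9 c d e f g h k l m = true ∧
    F9 d e f g h k l m n = false ∧ F9 e f g h k l m n o = false := by
  rintro rfl rfl rfl rfl rfl rfl rfl
  revert a b l m n o
  decide +kernel

set_option synthInstance.maxHeartbeats 400000 in
set_option synthInstance.maxSize 2000 in
theorem start_bool (a b c d e f i j k l m : Bool) :
    let g := false
    let h := true
    red a b c d e f g h i j = false → red b c d e f g h i j k = false →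
    red c d e f g h i j k l = false → red d e f g h i j k l m = false →
    ¬ (d = false ∧ e = false ∧ f = true ∧ i = false ∧ j = false) →
    ¬ (f = false ∧ i = false ∧ j = true ∧ k = false ∧ l = false) →
    ¬ (i = true ∧ j = false) → ¬ (k = true ∧ l = false) →
    (F9 c d e f g h i j k = false ∧ F9 d e f g h i j k l = true) ∨
    (F9 c d e f g h i j k = false ∧ F9 d e f g h i j k l = false ∧
      F9 a b c d e f g h i = false ∧ F9 b c d e f g h i j = true) := by
  dsimp only
  revert a b c d e f i j k l m
  decide +kernel

theorem end_bool (a b g h i j k l : Bool) :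
    let c := true
    let d := true
    let e := false
    let f := true
    red b c d e f g h i j k = false → red a b c d e f g h i j = false →
    ¬ (a = true ∧ b = false) →
    (F9 a b c d e f g h i = false ∧ F9 b c d e f g h i j = false) ∨
    (F9 a b c d e f g h i = false ∧ F9 b c d e f g h i j = true ∧
      F9 c d e f g h i j k = false ∧ F9 d e f g h i j k l = false) := by
  revert a b g h i j k l
  decide +kernel

/-- The statement for sequences: the block of `X` starts at index 10. -/
theorem core (X Y : ℕ → Bool)
    (hY : ∀ m, Y (m+4) = F9 (X m) (X (m+1)) (X (m+2)) (X (m+3)) (X (m+4)) (X (m+5)) (X (m+6))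
      (X (m+7)) (X (m+8)))
    (hR : ∀ m, red (X m) (X (m+1)) (X (m+2)) (X (m+3)) (X (m+4)) (X (m+5)) (X (m+6))
      (X (m+7)) (X (m+8)) (X (m+9)) = false)
    (hR2 : ∀ m, red (Y m) (Y (m+1)) (Y (m+2)) (Y (m+3)) (Y (m+4)) (Y (m+5)) (Y (m+6))
      (Y (m+7)) (Y (m+8)) (Y (m+9)) = false)
    (k : ℕ)
    (hp : ∀ j ≤ k, ¬ (X (10 + 2*j) = true ∧ X (10 + 2*j + 1) = false))
    (h0 : X 10 = false) (h1 : X 11 = true)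
    (hk0 : X (10 + 2*k) = true) (hk1 : X (10 + 2*k + 1) = true)
    (hk2 : X (10 + 2*k + 2) = false) (hk3 : X (10 + 2*k + 3) = true) :
    ∃ d ≤ 1, ∃ k', k < k' ∧
      (∀ j ≤ k', ¬ (Y (8 + 2*d + 2*j) = true ∧ Y (8 + 2*d + 2*j + 1) = false)) ∧
      (Y (8 + 2*d) = false ∧ Y (8 + 2*d + 1) = true) ∧
      Y (8 + 2*d + 2*k') = false ∧ Y (8 + 2*d + 2*k' + 1) = false := by
  have hk : 1 ≤ k := by
    rcases Nat.eq_zero_or_pos k with rfl | h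
    · simp [h0] at hk0
    · exact h
  have hp' : ∀ j ≤ k + 1, ¬ (X (10 + 2*j) = true ∧ X (10 + 2*j + 1) = false) := by
    intro j hj
    rcases Nat.lt_or_ge k j with h | h
    · obtain rfl : j = k + 1 := by omega
      rw [show 10 + 2 * (k+1) = 10 + 2*k + 2 by ring, hk2]
      simp
    · exact hp j h
  have hbox : ∀ m, ¬ (X (m+2) = false ∧ X (m+3) = false ∧ X (m+4) = true ∧ X (m+5) = false ∧
      X (m+6) = true ∧ X (m+7) = false ∧ X (m+8) = false) := by
    rintro m ⟨a, b, c, d, e, f, g⟩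
    obtain ⟨y0, y1, y2, y3, y4⟩ := box_step (X m) (X (m+1)) (X (m+2)) (X (m+3)) (X (m+4)) (X (m+5))
      (X (m+6)) (X (m+7)) (X (m+8)) (X (m+9)) (X (m+10)) (X (m+11)) (X (m+12)) a b c d e f g
    have r := hR2 (m+4)
    have e0 := hY m
    have e1 := hY (m+1)
    have e2 := hY (m+2)
    have e3 := hY (m+3)
    have e4 := hY (m+4)
    simp only [Nat.add_assoc, Nat.reduceAdd] at e0 e1 e2 e3 e4 r
    rw [y0] at e0; rw [y1] at e1; rw [y2] at e2; rw [y3] at e3; rw [y4] at e4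
    simp [red, e0, e1, e2, e3, e4] at r
  -- inner pairs
  have hmid : ∀ j, 1 ≤ j → j ≤ k → ¬ (Y (10 + 2*j) = true ∧ Y (10 + 2*j + 1) = false) := by
    intro j hj1 hjk
    have := mid_bool (X (6 + 2*j)) (X (6 + 2*j + 1)) (X (6 + 2*j + 2)) (X (6 + 2*j + 3))
      (X (6 + 2*j + 4)) (X (6 + 2*j + 5)) (X (6 + 2*j + 6)) (X (6 + 2*j + 7)) (X (6 + 2*j + 8))
      (X (6 + 2*j + 9))
    have q1 := hp' (j-1) (by omega)
    have q2 := hp' j (by omega)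
    have q3 := hp' (j+1) (by omega)
    rw [show 10 + 2*(j-1) = 6 + 2*j + 2 by omega] at q1
    rw [show 10 + 2*j = 6 + 2*j + 4 by omega] at q2
    rw [show 10 + 2*(j+1) = 6 + 2*j + 6 by omega] at q3
    have r := this q1 q2 q3
    rw [show 10 + 2*j = 6 + 2*j + 4 by omega, show 6 + 2*j + 4 + 1 = 6 + 2*j + 1 + 4 by omega,
      hY, hY]
    exact r
  -- right end
  have hend : ∃ k', k < k' ∧ (∀ j, k < j → j ≤ k' → ¬ (Y (10 + 2*j) = true ∧
      Y (10 + 2*j + 1) = false)) ∧ Y (10 + 2*k') = false ∧ Y (10 + 2*k' + 1) = false := by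
    have E := end_bool (X (8 + 2*k)) (X (8 + 2*k + 1)) (X (8 + 2*k + 6)) (X (8 + 2*k + 7))
      (X (8 + 2*k + 8)) (X (8 + 2*k + 9)) (X (8 + 2*k + 10)) (X (8 + 2*k + 11))
    have r1 := hR (8 + 2*k + 1)
    have r0 := hR (8 + 2*k)
    have q := hp' (k-1) (by omega)
    rw [show 10 + 2*(k-1) = 8 + 2*k by omega] at q
    have c2 : X (8 + 2*k + 2) = true := by rw [← hk0]; congr 1; omega
    have c3 : X (8 + 2*k + 3) = true := by rw [← hk1]; congr 1; omega
    have c4 : X (8 + 2*k + 4) = false := by rw [← hk2]; congr 1; omega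
    have c5 : X (8 + 2*k + 5) = true := by rw [← hk3]; congr 1; omega
    have e0 := hY (8 + 2*k)
    have e1 := hY (8 + 2*k + 1)
    have e2 := hY (8 + 2*k + 2)
    have e3 := hY (8 + 2*k + 3)
    simp only [Nat.add_assoc, Nat.reduceAdd] at e0 e1 e2 e3 r0 r1 E c2 c3 c4 c5 q
    simp only [c2, c3, c4, c5] at e0 e1 e2 e3 r0 r1
    have E' := E r1 r0 q
    simp only [← e0, ← e1, ← e2, ← e3] at E'
    rcases E' with ⟨a, b⟩ | ⟨a, b, c, d⟩
    · refine ⟨k+1, by omega, ?_, ?_, ?_⟩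
      · intro j h1 h2
        obtain rfl : j = k + 1 := by omega
        rw [show 10 + 2*(k+1) = 8 + (2*k + 4) by omega, a]; simp
      · rw [← a]; congr 1; omega
      · rw [← b]; congr 1; omega
    · refine ⟨k+2, by omega, ?_, ?_, ?_⟩
      · intro j h1 h2
        obtain rfl | rfl : j = k + 1 ∨ j = k + 2 := by omega
        · rw [show 10 + 2*(k+1) = 8 + (2*k + 4) by omega, a]; simp
        · rw [show 10 + 2*(k+2) = 8 + (2*k + 6) by omega, c]; simp
      · rw [← c]; congr 1; omega
      · rw [← d]; congr 1; omega
  obtain ⟨k', hkk, hr, hz0, hz1⟩ := hend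
  have hinner : ∀ j, 1 ≤ j → j ≤ k' → ¬ (Y (10 + 2*j) = true ∧ Y (10 + 2*j + 1) = false) := by
    intro j a b
    rcases Nat.lt_or_ge k j with h | h
    · exact hr j h b
    · exact hmid j a h
  -- left end
  have S := start_bool (X 4) (X 5) (X 6) (X 7) (X 8) (X 9) (X 12) (X 13) (X 14) (X 15) (X 16)
  have r4 := hR 4
  have r5 := hR 5
  have r6 := hR 6
  have r7 := hR 7
  have b5 := hbox 5
  have b7 := hbox 7
  have p1 := hp' 1 (by omega)
  have p2 := hp' 2 (by omega)
  have e8 := hY 4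
  have e9 := hY 5
  have e10 := hY 6
  have e11 := hY 7
  simp only [Nat.reduceAdd, Nat.reduceMul, h0, h1, true_and] at r4 r5 r6 r7 b5 b7 p1 p2 e8 e9 e10 e11
  have S' := S r4 r5 r6 r7 b5 b7 p1 p2
  simp only [← e8, ← e9, ← e10, ← e11] at S'
  rcases S' with ⟨a, b⟩ | ⟨a, b, c, d⟩
  · refine ⟨1, le_refl _, k', hkk, ?_, ⟨a, b⟩, hz0, hz1⟩
    intro j hj
    rcases Nat.eq_zero_or_pos j with rfl | h
    · simp [a]
    · exact hinner j h hj
  · refine ⟨0, by omega, k' + 1, by omega, ?_, ⟨c, d⟩, ?_, ?_⟩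
    · intro j hj
      rcases Nat.lt_or_ge j 2 with h | h
      · obtain rfl | rfl : j = 0 ∨ j = 1 := by omega
        · simp [c]
        · simp [a]
      · have := hinner (j-1) (by omega) (by omega)
        rw [show 8 + 2*0 + 2*j = 10 + 2*(j-1) by omega]
        exact this
    · rw [← hz0]; congr 1; omega
    · rw [← hz1]; congr 1; omega

end BFO

/-- If `x ∈ X_s` and `b` is a maximal ordered block of `x` ending
with `11`, then `F(x)` contains an ordered block strictly longer than `b`. -/
theorem Xs_maximal_block_grows (n : ℕ) (hn : Odd n) (x : ZMod n → Bool)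
    (hx : InXs x) (i : ZMod n) (k : ℕ) (hb : IsMaximalOrderedBlock x i k)
    (hend : x (i + 2*k) = true ∧ x (i + 2*k + 1) = true) :
    ∃ (i' : ZMod n) (k' : ℕ), IsOrderedBlock (bfoGlobal x) i' k' ∧ k < k' := by
  have hn0 : NeZero n := ⟨by rintro rfl; simp at hn⟩
  have s1 : switchCount (bfoGlobal x) = switchCount x := hx 1
  have s2 : switchCount (bfoGlobal (bfoGlobal x)) = switchCount (bfoGlobal x) := by
    rw [s1]; exact hx 2
  have hB := hb.1
  have hk2 : x (i + 2*k + 2) = false := hB.2.2.2 hend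
  have hk3 : x (i + 2*k + 3) = true := by
    by_contra hc
    rw [Bool.not_eq_true] at hc
    have e2 : i + 2*((k+1 : ℕ) : ZMod n) = i + 2*k + 2 := by push_cast; ring
    have e3 : i + 2*(k : ZMod n) + 2 + 1 = i + 2*k + 3 := by ring
    have hbig : IsOrderedBlock x i (k+1) := by
      refine ⟨?_, hB.2.1, ?_, ?_⟩
      · intro j hj
        rcases Nat.lt_or_ge k j with h | h
        · obtain rfl : j = k + 1 := by omega
          rw [e2, hk2]; simp
        · exact hB.1 j h
      · rw [e2, e3, hc]; simp
      · rw [e2, hk2]; simp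
    have := hb.2 i (k+1) 0 hbig (by simp) (by omega)
    omega
  obtain ⟨d, hd, k', hkk, hall, hs, hz0, hz1⟩ := BFO.core (fun m => x (i - 10 + (m : ZMod n)))
    (fun m => bfoGlobal x (i - 10 + (m : ZMod n)))
    (by
      intro m
      have := BFO.glob_eq x (i - 10 + (m : ZMod n))
      simp only [add_assoc] at this
      simp only [Nat.cast_add, Nat.cast_ofNat, Nat.cast_one]
      exact this)
    (by
      intro m
      have := BFO.no_red x s1 (i - 10 + (m : ZMod n))
      unfold BFO.redB at this
      simp only [add_assoc] at this
      simp only [Nat.cast_add, Nat.cast_ofNat, Nat.cast_one]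
      exact this)
    (by
      intro m
      have := BFO.no_red (bfoGlobal x) s2 (i - 10 + (m : ZMod n))
      unfold BFO.redB at this
      simp only [add_assoc] at this
      simp only [Nat.cast_add, Nat.cast_ofNat, Nat.cast_one]
      exact this)
    k
    (by
      intro j hj
      have := hB.1 j hj
      convert this using 4 <;> push_cast <;> ring)
    (by have := hB.2.1.1; convert this using 2; push_cast; ring)
    (by have := hB.2.1.2; convert this using 2; push_cast; ring)
    (by have := hend.1; convert this using 2; push_cast; ring)
    (by have := hend.2; convert this using 2; push_cast; ring)
    (by convert hk2 using 2; push_cast; ring)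
    (by convert hk3 using 2; push_cast; ring)
  have c0 : ∀ j : ℕ, i - 2 + 2 * (d : ZMod n) + 2 * (j : ZMod n)
      = i - 10 + ((8 + 2*d + 2*j : ℕ) : ZMod n) := by
    intro j; push_cast; ring
  have c1 : ∀ j : ℕ, i - 10 + ((8 + 2*d + 2*j : ℕ) : ZMod n) + 1
      = i - 10 + ((8 + 2*d + 2*j + 1 : ℕ) : ZMod n) := by
    intro j; push_cast; ring
  have c2 : i - 2 + 2 * (d : ZMod n) = i - 10 + ((8 + 2*d : ℕ) : ZMod n) := by push_cast; ring
  have c3 : i - 10 + ((8 + 2*d : ℕ) : ZMod n) + 1 = i - 10 + ((8 + 2*d + 1 : ℕ) : ZMod n) := by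
    push_cast; ring
  refine ⟨i - 2 + 2 * (d : ZMod n), k', ⟨?_, ?_, ?_, ?_⟩, hkk⟩
  · intro j hj
    rw [c0, c1]
    exact hall j hj
  · rw [c2, c3]; exact hs
  · rw [c0, c1]; rintro ⟨_, h⟩
    exact absurd (hz1.symm.trans h) (by decide)
  · rw [c0, c1]; rintro ⟨h, _⟩
    exact absurd (hz0.symm.trans h) (by decide)
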